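/- (Corollary of Proposition 1) Let π_X, π_Y ∈ (0,1) and p₀₀, p₀₁, p'₀₀, p'₀₁ ∈ [0,1], and suppose the feasible set { (λ_A, λ_B, c) : c ∈ Δ^15, A(π_Y)·c = a_{p₀₀,p₀₁}(λ_A), B(π_X)·c = a_{p'₀₀,p'₀₁}(λ_B) } is nonempty. Then the maximum of λ_A over this feasible set equals min(p₀₀, p₀₁), and the maximum of λ_B over this feasible set equals min(p'₀₀, p'₀₁). -/

import Mathlib

/-- The four Boolean response functions: `f₀ ≡ 0`, `f₁ ≡ 1`, `f₂ = id`, `f₃ = not`. -/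
def fRes : Fin 4 → Bool → Bool := ![fun _ => false, fun _ => true, fun x => x, fun x => !x]

/-- The sixteen joint response functions `h_k(x,y) = (k / 2^(2x+y)) % 2`. -/
def hRes (k : Fin 16) (x y : Bool) : Bool :=
  (((k : ℕ) / 2 ^ (2 * x.toNat + y.toNat)) % 2) == 1

/-- The 4×16 marginalisation matrix `A(π)` with entries
`A(π)_{jk} = (1−π)·1{h_k(·,0)=f_j} + π·1{h_k(·,1)=f_j}`. -/
noncomputable def Amat (p : ℝ) : Matrix (Fin 4) (Fin 16) ℝ :=
  Matrix.of fun j k =>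
    (1 - p) * (if (fun x => hRes k x false) = fRes j then (1 : ℝ) else 0)
      + p * (if (fun x => hRes k x true) = fRes j then (1 : ℝ) else 0)

/-- The 4×16 marginalisation matrix `B(π)` with entries
`B(π)_{jk} = (1−π)·1{h_k(0,·)=f_j} + π·1{h_k(1,·)=f_j}`. -/
noncomputable def Bmat (p : ℝ) : Matrix (Fin 4) (Fin 16) ℝ :=
  Matrix.of fun j k =>
    (1 - p) * (if (fun y => hRes k false y) = fRes j then (1 : ℝ) else 0)
      + p * (if (fun y => hRes k true y) = fRes j then (1 : ℝ) else 0)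

/-- `a_{p,q}(λ) = (λ, 1−p−q+λ, p−λ, q−λ)`. -/
def avec (p q lam : ℝ) : Fin 4 → ℝ := ![lam, 1 - p - q + lam, p - lam, q - lam]

open Matrix

lemma Amat_mulVec (p : ℝ) (c : Fin 16 → ℝ) :
    Amat p *ᵥ c =
      (1 - p) • ![c 0 + c 2 + c 8 + c 10, c 5 + c 7 + c 13 + c 15,
        c 4 + c 6 + c 12 + c 14, c 1 + c 3 + c 9 + c 11] +
      p • ![c 0 + c 1 + c 4 + c 5, c 10 + c 11 + c 14 + c 15,
        c 8 + c 9 + c 12 + c 13, c 2 + c 3 + c 6 + c 7] := by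
  ext j
  fin_cases j <;>
    simp [Amat, mulVec, dotProduct, Fin.sum_univ_succ, fRes, hRes, funext_iff, Fin.succ] <;> ring

/-- The permutation of the joint response functions induced by exchanging `x` and `y`. -/
def flipPerm : Equiv.Perm (Fin 16) :=
  Equiv.swap 2 4 * Equiv.swap 3 5 * Equiv.swap 10 12 * Equiv.swap 11 13

lemma hRes_flipPerm : ∀ k x y, hRes (flipPerm k) x y = hRes k y x := by decide

lemma flipPerm_symm : flipPerm.symm = flipPerm := by decide

lemma Amat_mulVec_flip (p : ℝ) (c : Fin 16 → ℝ) :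
    Amat p *ᵥ (c ∘ flipPerm) = Bmat p *ᵥ c := by
  have h : Bmat p = (Amat p).submatrix id flipPerm := by
    ext j k
    simp [Amat, Bmat, hRes_flipPerm]
  rw [h, submatrix_mulVec_equiv, flipPerm_symm]
  rfl

lemma Bmat_mulVec_flip (p : ℝ) (c : Fin 16 → ℝ) :
    Bmat p *ᵥ (c ∘ flipPerm) = Amat p *ᵥ c := by
  rw [← Amat_mulVec_flip]
  congr 1
  ext k
  have h : flipPerm (flipPerm k) = k := by
    simpa [flipPerm_symm] using flipPerm.symm_apply_apply k
  simp [h]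

lemma comp_flipPerm_mem {c : Fin 16 → ℝ} (hc : c ∈ stdSimplex ℝ (Fin 16)) :
    c ∘ flipPerm ∈ stdSimplex ℝ (Fin 16) :=
  ⟨fun _ => hc.1 _, (Equiv.sum_comp flipPerm c).trans hc.2⟩

/-- The `c`-mass of the joint response functions vanishing at `(x, y)`. -/
def zeroMass (c : Fin 16 → ℝ) (x y : Bool) : ℝ :=
  ∑ k, if hRes k x y then 0 else c k

lemma zeroMass_nonneg {c : Fin 16 → ℝ} (hc : c ∈ stdSimplex ℝ (Fin 16)) (x y : Bool) :
    0 ≤ zeroMass c x y :=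
  Finset.sum_nonneg fun k _ => by split_ifs; exacts [le_rfl, hc.1 k]

lemma zeroMass_le_one {c : Fin 16 → ℝ} (hc : c ∈ stdSimplex ℝ (Fin 16)) (x y : Bool) :
    zeroMass c x y ≤ 1 :=
  hc.2 ▸ Finset.sum_le_sum fun k _ => by split_ifs; exacts [hc.1 k, le_rfl]

lemma zeroMass_flip (c : Fin 16 → ℝ) (x y : Bool) :
    zeroMass (c ∘ flipPerm) x y = zeroMass c y x := by
  unfold zeroMass
  rw [← Equiv.sum_comp flipPerm fun k => if hRes k y x then 0 else c k]
  simp [hRes_flipPerm]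

lemma exists_Amat_mulVec_eq_avec_iff {p q r : ℝ} {c : Fin 16 → ℝ}
    (hc : c ∈ stdSimplex ℝ (Fin 16)) :
    (∃ lam, Amat p *ᵥ c = avec q r lam) ↔
      (1 - p) * zeroMass c false false + p * zeroMass c false true = q ∧
      (1 - p) * zeroMass c true false + p * zeroMass c true true = r := by
  have hsum := hc.2
  simp only [Amat_mulVec, avec, zeroMass, funext_iff, Fin.forall_fin_succ]
  simp [Fin.sum_univ_succ, hRes, Fin.succ] at hsum ⊢
  constructor
  · rintro ⟨h1, h2, h3⟩
    constructor <;> linarith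
  · rintro ⟨h1, h2⟩
    refine ⟨?_, ?_, ?_⟩
    · linear_combination hsum - h1 - h2
    · linear_combination h1
    · linear_combination h2

lemma exists_Bmat_mulVec_eq_avec_iff {p q r : ℝ} {c : Fin 16 → ℝ}
    (hc : c ∈ stdSimplex ℝ (Fin 16)) :
    (∃ lam, Bmat p *ᵥ c = avec q r lam) ↔
      (1 - p) * zeroMass c false false + p * zeroMass c true false = q ∧
      (1 - p) * zeroMass c false true + p * zeroMass c true true = r := by
  simp only [← Amat_mulVec_flip, exists_Amat_mulVec_eq_avec_iff (comp_flipPerm_mem hc),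
    zeroMass_flip]

/-- The joint response distribution under which the slices `h(·, 0)` and `h(·, 1)` are
independent with distributions `a` and `b`. -/
def indepSlices (a b : Fin 4 → ℝ) (k : Fin 16) : ℝ :=
  a (![0, 3, 0, 3, 2, 1, 2, 1, 0, 3, 0, 3, 2, 1, 2, 1] k) *
    b (![0, 0, 3, 3, 0, 0, 3, 3, 2, 2, 1, 1, 2, 2, 1, 1] k)

lemma indepSlices_mem {a b : Fin 4 → ℝ} (ha : a ∈ stdSimplex ℝ (Fin 4))
    (hb : b ∈ stdSimplex ℝ (Fin 4)) : indepSlices a b ∈ stdSimplex ℝ (Fin 16) := by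
  refine ⟨fun k => mul_nonneg (ha.1 _) (hb.1 _), ?_⟩
  have h : ∑ k, indepSlices a b k = (∑ i, a i) * ∑ j, b j := by
    simp [indepSlices, Fin.sum_univ_succ, Fin.succ]
    ring
  rw [h, ha.2, hb.2, one_mul]

lemma Amat_mulVec_indepSlices (p : ℝ) {a b : Fin 4 → ℝ} (ha : a ∈ stdSimplex ℝ (Fin 4))
    (hb : b ∈ stdSimplex ℝ (Fin 4)) : Amat p *ᵥ indepSlices a b = (1 - p) • a + p • b := by
  have hA := ha.2
  have hB := hb.2
  rw [Fin.sum_univ_four] at hA hB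
  rw [Amat_mulVec]
  ext j
  fin_cases j <;> simp [indepSlices]
  · linear_combination (1 - p) * a 0 * hB + p * b 0 * hA
  · linear_combination (1 - p) * a 1 * hB + p * b 1 * hA
  · linear_combination (1 - p) * a 2 * hB + p * b 2 * hA
  · linear_combination (1 - p) * a 3 * hB + p * b 3 * hA

lemma zeroMass_indepSlices {a b : Fin 4 → ℝ} (ha : a ∈ stdSimplex ℝ (Fin 4))
    (hb : b ∈ stdSimplex ℝ (Fin 4)) :
    zeroMass (indepSlices a b) false false = a 0 + a 2 ∧
    zeroMass (indepSlices a b) true false = a 0 + a 3 ∧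
    zeroMass (indepSlices a b) false true = b 0 + b 2 ∧
    zeroMass (indepSlices a b) true true = b 0 + b 3 := by
  have hA := ha.2
  have hB := hb.2
  rw [Fin.sum_univ_four] at hA hB
  simp [zeroMass, indepSlices, Fin.sum_univ_succ, hRes, Fin.succ]
  refine ⟨?_, ?_, ?_, ?_⟩
  · linear_combination (a 0 + a 2) * hB
  · linear_combination (a 0 + a 3) * hB
  · linear_combination (b 0 + b 2) * hA
  · linear_combination (b 0 + b 3) * hA

lemma avec_min_mem {m n : ℝ} (hm : m ∈ Set.Icc (0 : ℝ) 1) (hn : n ∈ Set.Icc (0 : ℝ) 1) :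
    avec m n (min m n) ∈ stdSimplex ℝ (Fin 4) := by
  obtain ⟨hm0, hm1⟩ := hm
  obtain ⟨hn0, hn1⟩ := hn
  constructor
  · intro j
    fin_cases j <;> rcases min_cases m n with ⟨h, h'⟩ | ⟨h, h'⟩ <;> simp [avec, h] <;> linarith
  · simp [avec, Fin.sum_univ_four]
    ring

/-- A 2×2 table whose first row has `π`-average at most that of its second row can be changed,
keeping the `π`-averages of its rows and the `ρ`-averages of its columns, so that its first row
is entrywise at most its second row. -/
lemma exists_table_row_le {π ρ : ℝ} (hπ : π ∈ Set.Ioo (0 : ℝ) 1) (hρ : ρ ∈ Set.Icc (0 : ℝ) 1)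
    {m : Bool → Bool → ℝ} (hm : ∀ x y, m x y ∈ Set.Icc (0 : ℝ) 1)
    (h : (1 - π) * m false false + π * m false true ≤
      (1 - π) * m true false + π * m true true) :
    ∃ n : Bool → Bool → ℝ, (∀ x y, n x y ∈ Set.Icc (0 : ℝ) 1) ∧
      (∀ x, (1 - π) * n x false + π * n x true = (1 - π) * m x false + π * m x true) ∧
      (∀ y, (1 - ρ) * n false y + ρ * n true y = (1 - ρ) * m false y + ρ * m true y) ∧
      ∀ y, n false y ≤ n true y := by
  have of_shift : ∀ t : ℝ,
      (∀ x y, m x y + (if x then -(1 - ρ) else ρ) * ((if y then -(1 - π) else π) * t) ∈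
        Set.Icc (0 : ℝ) 1) →
      (∀ y, m false y + (if y then -(1 - π) else π) * t ≤ m true y) →
      ∃ n : Bool → Bool → ℝ, (∀ x y, n x y ∈ Set.Icc (0 : ℝ) 1) ∧
        (∀ x, (1 - π) * n x false + π * n x true = (1 - π) * m x false + π * m x true) ∧
        (∀ y, (1 - ρ) * n false y + ρ * n true y = (1 - ρ) * m false y + ρ * m true y) ∧
        ∀ y, n false y ≤ n true y := fun t h₁ h₂ =>
    ⟨fun x y => m x y + (if x then -(1 - ρ) else ρ) * ((if y then -(1 - π) else π) * t), h₁,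
      fun x => by simp only [if_true, Bool.false_eq_true, if_false]; ring,
      fun y => by simp only [if_true, Bool.false_eq_true, if_false]; ring,
      fun y => by
        have := h₂ y
        simp only [if_true, Bool.false_eq_true, if_false]
        linarith⟩
  obtain ⟨hπ0, hπ1⟩ := hπ
  obtain ⟨hρ0, hρ1⟩ := hρ
  obtain ⟨a0, a1⟩ := hm false false
  obtain ⟨b0, b1⟩ := hm false true
  obtain ⟨c0, c1⟩ := hm true false
  obtain ⟨d0, d1⟩ := hm true true
  rcases lt_or_ge (m true false) (m false false) with h0 | h0
  · obtain ⟨t, ht⟩ : ∃ t, π * t = m true false - m false false :=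
      ⟨_, mul_div_cancel₀ _ hπ0.ne'⟩
    have ht0 : (1 - π) * t ≤ 0 := by nlinarith
    have ht1 : -((1 - π) * t) ≤ m true true - m false true := by nlinarith
    refine of_shift t ?_ ?_
    · rintro (_ | _) (_ | _) <;> constructor <;> simp [-neg_sub, ht] <;> nlinarith
    · rintro (_ | _) <;> simp [-neg_sub, ht] <;> nlinarith
  rcases lt_or_ge (m true true) (m false true) with h1 | h1
  · obtain ⟨t, ht⟩ : ∃ t, (1 - π) * t = m false true - m true true :=
      ⟨_, mul_div_cancel₀ _ (sub_pos.2 hπ1).ne'⟩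
    have ht0 : 0 ≤ π * t := by nlinarith
    have ht1 : π * t ≤ m true false - m false false := by nlinarith
    refine of_shift t ?_ ?_
    · rintro (_ | _) (_ | _) <;> constructor <;> simp [-neg_sub, ht] <;> nlinarith
    · rintro (_ | _) <;> simp [-neg_sub, ht] <;> nlinarith
  · exact of_shift 0 (by simpa using hm) (by rintro (_ | _) <;> simpa)

lemma exists_table_rows_comparable {π ρ : ℝ} (hπ : π ∈ Set.Ioo (0 : ℝ) 1)
    (hρ : ρ ∈ Set.Icc (0 : ℝ) 1) {m : Bool → Bool → ℝ} (hm : ∀ x y, m x y ∈ Set.Icc (0 : ℝ) 1) :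
    ∃ n : Bool → Bool → ℝ, (∀ x y, n x y ∈ Set.Icc (0 : ℝ) 1) ∧
      (∀ x, (1 - π) * n x false + π * n x true = (1 - π) * m x false + π * m x true) ∧
      (∀ y, (1 - ρ) * n false y + ρ * n true y = (1 - ρ) * m false y + ρ * m true y) ∧
      ((∀ y, n false y ≤ n true y) ∨ ∀ y, n true y ≤ n false y) := by
  rcases le_total ((1 - π) * m false false + π * m false true)
    ((1 - π) * m true false + π * m true true) with h | h
  · obtain ⟨n, hn, hrow, hcol, hle⟩ := exists_table_row_le hπ hρ hm h
    exact ⟨n, hn, hrow, hcol, .inl hle⟩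
  · obtain ⟨n, hn, hrow, hcol, hle⟩ := exists_table_row_le (m := fun x => m !x) hπ
      (ρ := 1 - ρ) ⟨sub_nonneg.2 hρ.2, sub_le_self _ hρ.1⟩ (fun x => hm !x) h
    refine ⟨fun x => n !x, fun x => hn !x, fun x => by simpa using hrow !x, fun y => ?_,
      .inr hle⟩
    have := hcol y
    simp only [Bool.not_false, Bool.not_true] at this ⊢
    linarith

lemma Amat_mulVec_nonneg {p : ℝ} (hp : p ∈ Set.Icc (0 : ℝ) 1) {c : Fin 16 → ℝ}
    (hc : c ∈ stdSimplex ℝ (Fin 16)) (j : Fin 4) : 0 ≤ (Amat p *ᵥ c) j := by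
  have h : 0 ≤ 1 - p := sub_nonneg.2 hp.2
  have hp0 := hp.1
  rw [mulVec, dotProduct]
  refine Finset.sum_nonneg fun k _ => mul_nonneg ?_ (hc.1 k)
  simp only [Amat, of_apply]
  positivity

lemma isGreatest_fst_lambda {π ρ p q p' q' : ℝ} (hπ : π ∈ Set.Ioo (0 : ℝ) 1)
    (hρ : ρ ∈ Set.Icc (0 : ℝ) 1)
    (hfeas : ∃ (lam lam' : ℝ) (c : Fin 16 → ℝ), c ∈ stdSimplex ℝ (Fin 16) ∧
      Amat π *ᵥ c = avec p q lam ∧ Bmat ρ *ᵥ c = avec p' q' lam') :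
    IsGreatest {lam : ℝ | ∃ (lam' : ℝ) (c : Fin 16 → ℝ), c ∈ stdSimplex ℝ (Fin 16) ∧
      Amat π *ᵥ c = avec p q lam ∧ Bmat ρ *ᵥ c = avec p' q' lam'} (min p q) := by
  constructor
  · obtain ⟨lam, lam', c, hc, hA, hB⟩ := hfeas
    obtain ⟨hp, hq⟩ := (exists_Amat_mulVec_eq_avec_iff hc).1 ⟨lam, hA⟩
    obtain ⟨hp', hq'⟩ := (exists_Bmat_mulVec_eq_avec_iff hc).1 ⟨lam', hB⟩
    obtain ⟨n, hn, hrow, hcol, hle⟩ := exists_table_rows_comparable hπ hρ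
      (m := zeroMass c) fun x y => ⟨zeroMass_nonneg hc x y, zeroMass_le_one hc x y⟩
    have ha := avec_min_mem (hn false false) (hn true false)
    have hb := avec_min_mem (hn false true) (hn true true)
    have hd := indepSlices_mem ha hb
    obtain ⟨h00, h10, h01, h11⟩ := zeroMass_indepSlices ha hb
    simp only [avec, cons_val, add_sub_cancel] at h00 h10 h01 h11
    obtain ⟨lam'', hB'⟩ := (exists_Bmat_mulVec_eq_avec_iff (p := ρ) (q := p') (r := q') hd).2
      ⟨by simp only [avec, h00, h10]; rw [hcol, hp'],
        by simp only [avec, h01, h11]; rw [hcol, hq']⟩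
    refine ⟨lam'', _, hd, ?_, hB'⟩
    have hp₁ := (hrow false).trans hp
    have hq₁ := (hrow true).trans hq
    have hmin : (1 - π) * min (n false false) (n true false) +
        π * min (n false true) (n true true) = min p q := by
      have h₁ : 0 ≤ 1 - π := sub_nonneg.2 hπ.2.le
      rcases hle with hle | hle
      · rw [min_eq_left (hle _), min_eq_left (hle _), hp₁, min_eq_left]
        rw [← hp₁, ← hq₁]
        gcongr
        exacts [hle _, hπ.1.le, hle _]
      · rw [min_eq_right (hle _), min_eq_right (hle _), hq₁, min_eq_right]
        rw [← hp₁, ← hq₁]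
        gcongr
        exacts [hle _, hπ.1.le, hle _]
    rw [Amat_mulVec_indepSlices π ha hb, ← hmin, ← hp₁, ← hq₁]
    ext j
    fin_cases j <;> simp [avec] <;> ring
  · rintro lam ⟨lam', c, hc, hA, -⟩
    have h := Amat_mulVec_nonneg (Set.Ioo_subset_Icc_self hπ) hc
    rw [hA] at h
    exact le_min (sub_nonneg.1 (h 2)) (sub_nonneg.1 (h 3))

/-- **Corollary of Proposition 1.** Over the nonempty feasible set,
the maximum of `λ_A` is `min(p₀₀,p₀₁)` and the maximum of `λ_B` is `min(p'₀₀,p'₀₁)`. -/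
theorem cor_lambda_max (piX piY p00 p01 p00' p01' : ℝ)
    (hpiX : piX ∈ Set.Ioo (0 : ℝ) 1) (hpiY : piY ∈ Set.Ioo (0 : ℝ) 1)
    (hp00 : p00 ∈ Set.Icc (0 : ℝ) 1) (hp01 : p01 ∈ Set.Icc (0 : ℝ) 1)
    (hp00' : p00' ∈ Set.Icc (0 : ℝ) 1) (hp01' : p01' ∈ Set.Icc (0 : ℝ) 1)
    (hfeas : ∃ (lamA lamB : ℝ) (c : Fin 16 → ℝ),
      c ∈ stdSimplex ℝ (Fin 16) ∧
      (Amat piY).mulVec c = avec p00 p01 lamA ∧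
      (Bmat piX).mulVec c = avec p00' p01' lamB) :
    IsGreatest {lamA : ℝ | ∃ (lamB : ℝ) (c : Fin 16 → ℝ),
        c ∈ stdSimplex ℝ (Fin 16) ∧
        (Amat piY).mulVec c = avec p00 p01 lamA ∧
        (Bmat piX).mulVec c = avec p00' p01' lamB} (min p00 p01) ∧
    IsGreatest {lamB : ℝ | ∃ (lamA : ℝ) (c : Fin 16 → ℝ),
        c ∈ stdSimplex ℝ (Fin 16) ∧
        (Amat piY).mulVec c = avec p00 p01 lamA ∧
        (Bmat piX).mulVec c = avec p00' p01' lamB} (min p00' p01') := by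
  refine ⟨isGreatest_fst_lambda hpiY (Set.Ioo_subset_Icc_self hpiX) hfeas, ?_⟩
  obtain ⟨lamA, lamB, c, hc, hA, hB⟩ := hfeas
  convert isGreatest_fst_lambda (p := p00') (q := p01') (p' := p00) (q' := p01) hpiX
    (Set.Ioo_subset_Icc_self hpiY)
    ⟨lamB, lamA, _, comp_flipPerm_mem hc, by rwa [Amat_mulVec_flip],
      by rwa [Bmat_mulVec_flip]⟩ using 1
  ext lam
  constructor
  · rintro ⟨lam', d, hd, hA, hB⟩
    exact ⟨lam', _, comp_flipPerm_mem hd, by rwa [Amat_mulVec_flip], by rwa [Bmat_mulVec_flip]⟩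
  · rintro ⟨lam', d, hd, hA, hB⟩
    exact ⟨lam', _, comp_flipPerm_mem hd, by rwa [Amat_mulVec_flip], by rwa [Bmat_mulVec_flip]⟩
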